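/- arXiv:1112.3421 — 5 statements merged into one kernel-verified Lean document; each statement's English description precedes it below -/
import Mathlib

section
/- The locally defined neighborhoods determine a topology on the sequence space: there exists a topology on the space of sequences ℕ → E such that for every sequence f, the collection of sets O_N f = {g : ℕ → E | for every t ∈ K there exist k > 0 and n ∈ ℕ such that for all i > n, q_t(f i - g i) < N t - k}, as N ranges over all families (N t)_{t ∈ K} of positive real numbers, forms a neighborhood basis of f. -/
open Filter

/-- The locally defined neighborhoods
`O_N f = {g | ∀ t, ∃ k > 0, ∃ n, ∀ i > n, q_t (f i - g i) < N t - k}`, as `N` ranges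
over families of positive reals, form a neighborhood basis of each sequence `f` for
some topology on the sequence space `ℕ → E` (the local `Q`-topology). -/
theorem local_Q_topology_sequences (E : Type*) [AddCommGroup E] [Module ℝ E]
    {K : Type*} (q : K → Seminorm ℝ E) :
    ∃ T : TopologicalSpace (ℕ → E), ∀ f : ℕ → E,
      (@nhds (ℕ → E) T f).HasBasis (fun N : K → ℝ => ∀ t, 0 < N t)
        (fun N => {g : ℕ → E |
          ∀ t, ∃ k > 0, ∃ n : ℕ, ∀ i > n, q t (f i - g i) < N t - k}) := by
  set O : (ℕ → E) → (K → ℝ) → Set (ℕ → E) := fun f N =>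
    {g | ∀ t, ∃ k > 0, ∃ n : ℕ, ∀ i > n, q t (f i - g i) < N t - k}
  have mono : ∀ f {M N : K → ℝ}, (∀ t, M t ≤ N t) → O f M ⊆ O f N := by
    intro f M N h g hg t
    obtain ⟨k, hk, n, hn⟩ := hg t
    exact ⟨k, hk, n, fun i hi => (hn i hi).trans_le (sub_le_sub_right (h t) k)⟩
  have isBasis : ∀ f, IsBasis (fun N : K → ℝ => ∀ t, 0 < N t) (O f) := fun f =>
    { nonempty := ⟨fun _ => 1, fun _ => one_pos⟩
      inter := fun {M N} hM hN => ⟨fun t => min (M t) (N t), fun t => lt_min (hM t) (hN t),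
        Set.subset_inter (mono f fun _ => min_le_left _ _) (mono f fun _ => min_le_right _ _)⟩ }
  have basis : ∀ f, (isBasis f).filter.HasBasis (fun N : K → ℝ => ∀ t, 0 < N t) (O f) :=
    fun f => (isBasis f).hasBasis
  refine ⟨.mkOfNhds fun f => (isBasis f).filter, fun f => ?_⟩
  rw [TopologicalSpace.nhds_mkOfNhds_of_hasBasis basis]
  · exact basis f
  · intro f N hN t
    refine ⟨N t / 2, half_pos (hN t), 0, fun i _ => ?_⟩
    rw [sub_self, map_zero, sub_half]
    exact half_pos (hN t)
  · intro f N hN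
    refine mem_of_superset ((basis f).mem_of_mem hN) fun g hg => ?_
    choose k hk n hn using hg
    refine mem_of_superset ((basis g).mem_of_mem hk) fun h hh t => ?_
    obtain ⟨l, hl, m, hm⟩ := hh t
    refine ⟨l, hl, max (n t) m, fun i hi => ?_⟩
    have hfg := hn t i ((le_max_left _ _).trans_lt hi)
    have hgh := hm i ((le_max_right _ _).trans_lt hi)
    have tri := map_add_le_add (q t) (f i - g i) (g i - h i)
    rw [sub_add_sub_cancel] at tri
    linarith
end

section
/- The hyperspace is Hausdorff: if f, g : ℕ → E are sequences with ¬(f ≈_Q g), then there exists r > 0 such that for all sequences u, v : ℕ → E, if u belongs to the uniform neighborhood O_r f and v belongs to the uniform neighborhood O_r g, then ¬(u ≈_Q v); that is, the images of O_r f and O_r g in the quotient (ℕ → E)/≈_Q are disjoint. -/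
open Filter

/-- The hyperspace is Hausdorff: if `¬(f ≈_Q g)`, then there is `r > 0` such that
no element of the uniform neighborhood `O_r f` is `≈_Q`-equivalent to any element
of the uniform neighborhood `O_r g`; that is, the images of `O_r f` and `O_r g` in
the quotient by `≈_Q` are disjoint. -/
theorem hyperspace_hausdorff (E : Type*) [AddCommGroup E] [Module ℝ E]
    (Q : Set (Seminorm ℝ E)) (f g : ℕ → E)
    (hfg : ¬ ∀ q ∈ Q, Tendsto (fun i => q (f i - g i)) atTop (nhds 0)) :
    ∃ r > 0, ∀ u v : ℕ → E,
      (∃ k > 0, ∀ q ∈ Q, ∃ n : ℕ, ∀ i > n, q (f i - u i) < r - k) →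
      (∃ k > 0, ∀ q ∈ Q, ∃ n : ℕ, ∀ i > n, q (g i - v i) < r - k) →
      ¬ ∀ q ∈ Q, Tendsto (fun i => q (u i - v i)) atTop (nhds 0) := by
  push Not at hfg
  obtain ⟨q, hq, hlim⟩ := hfg
  obtain ⟨ε, hε, hfreq⟩ : ∃ ε > 0, ∃ᶠ i in atTop, ε ≤ q (f i - g i) := by
    by_contra! h
    refine hlim (tendsto_order.2 ⟨fun a ha => ?_, fun ε hε => ?_⟩)
    · exact Eventually.of_forall fun i => ha.trans_le (apply_nonneg q _)
    · simpa only [not_frequently, not_le] using h ε hε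
  refine ⟨ε / 2, half_pos hε, ?_⟩
  rintro u v ⟨k, hk, hu⟩ ⟨l, hl, hv⟩ huv
  obtain ⟨m, hm⟩ := hu q hq
  obtain ⟨n, hn⟩ := hv q hq
  obtain ⟨i, hi, him, hin, hik⟩ := (hfreq.and_eventually ((eventually_gt_atTop m).and
    ((eventually_gt_atTop n).and ((huv q hq).eventually_lt_const hk)))).exists
  have htri : q (f i - g i) ≤ q (f i - u i) + q (u i - v i) + q (g i - v i) := by
    rw [map_sub_rev q (g i), ← sub_add_sub_cancel (f i) (v i) (g i),
      ← sub_add_sub_cancel (f i) (u i) (v i)]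
    exact (map_add_le_add q _ _).trans (by gcongr; exact map_add_le_add q _ _)
  linarith [hm i him, hn i hin]
end

section
/- If (h i)_{i ∈ ℕ} is a sequence of differentiable functions ℝ → ℝ whose derivatives converge to zero uniformly on every compact interval (i.e., for every a ≤ b, sup_{x ∈ [a,b]} |(h i)'(x)| → 0 as i → ∞), then for all real numbers c and d, h i (c) - h i (d) → 0 as i → ∞. Consequently, a compactwise extrafunction whose sectional derivative along a differentially represented section is zero is a constant extrafunction. -/
open Filter

/-- If `(h i)` is a sequence of differentiable functions `ℝ → ℝ` whose derivatives
converge to zero uniformly on every compact interval, then `h i c - h i d → 0` for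
all reals `c, d`. Consequently a compactwise extrafunction whose sectional
derivative along a differentially represented section is zero is constant. -/
theorem deriv_uniform_zero_implies_constant (h : ℕ → ℝ → ℝ)
    (hdiff : ∀ i, Differentiable ℝ (h i))
    (hderiv : ∀ a b : ℝ, a ≤ b →
      TendstoUniformlyOn (fun i => deriv (h i)) 0 atTop (Set.Icc a b)) :
    ∀ c d : ℝ, Tendsto (fun i => h i c - h i d) atTop (nhds 0) := by
  intro c d
  rw [Metric.tendsto_nhds]
  intro ε hε
  have hpos : 0 < |c - d| + 1 := by positivity
  have hδ : 0 < ε / (|c - d| + 1) := div_pos hε hpos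
  filter_upwards [Metric.tendstoUniformlyOn_iff.mp
    (hderiv (min c d) (max c d) min_le_max) _ hδ] with i hi
  have hbound : ∀ x ∈ Set.uIcc c d, ‖deriv (h i) x‖ ≤ ε / (|c - d| + 1) := by
    intro x hx
    simpa using (hi x hx).le
  have hmvt := (convex_uIcc c d).norm_image_sub_le_of_norm_deriv_le
    (fun x _ => hdiff i x) hbound Set.right_mem_uIcc Set.left_mem_uIcc
  rw [dist_zero_right]
  refine hmvt.trans_lt ?_
  rw [Real.norm_eq_abs, div_mul_eq_mul_div, div_lt_iff₀ hpos]
  exact mul_lt_mul_of_pos_left (lt_add_one _) hε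
end

section
/- Every compactwise extrafunction has a differentiable representing sequence: for every sequence (f i)_{i ∈ ℕ} of continuous functions ℝ → ℝ there exists a sequence (g i)_{i ∈ ℕ} of infinitely differentiable functions (indeed, polynomial functions) such that for every compact interval [a,b], sup_{x ∈ [a,b]} |f i (x) - g i (x)| → 0 as i → ∞. Hence the bundle of compactwise extrafunctions has differentially represented sections and all compactwise extrafunctions are differentiable. -/
open Filter

/-- Every compactwise extrafunction has a differentiable representing sequence: any
sequence of continuous functions `ℝ → ℝ` is `≈_comp`-equivalent to a sequence of
infinitely differentiable (indeed polynomial) functions, the equivalence being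
uniform convergence of the difference to zero on every compact interval. Hence the
bundle of compactwise extrafunctions has differentially represented sections and
all compactwise extrafunctions are differentiable. -/
theorem compactwise_differentially_represented (f : ℕ → ℝ → ℝ)
    (hf : ∀ i, Continuous (f i)) :
    ∃ g : ℕ → ℝ → ℝ,
      (∀ i, ∃ p : Polynomial ℝ, g i = fun x => p.eval x) ∧
      (∀ i, ContDiff ℝ (⊤ : ℕ∞) (g i)) ∧
      ∀ a b : ℝ, TendstoUniformlyOn (fun i x => f i x - g i x) 0 atTop (Set.Icc a b) := by
  choose p hp using fun i : ℕ =>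
    exists_polynomial_near_of_continuousOn (-(i : ℝ)) i (f i) (hf i).continuousOn
      (1 / ((i : ℝ) + 1)) Nat.one_div_pos_of_nat
  refine ⟨fun i x => (p i).eval x, fun i => ⟨p i, rfl⟩, fun i => by simpa using (p i).contDiff_aeval (𝕜 := ℝ) _, fun a b => ?_⟩
  rw [Metric.tendstoUniformlyOn_iff]
  intro ε hε
  filter_upwards [(tendsto_order.1 (tendsto_one_div_add_atTop_nhds_zero_nat (𝕜 := ℝ))).2 ε hε,
    tendsto_natCast_atTop_atTop.eventually_ge_atTop (-a),
    tendsto_natCast_atTop_atTop.eventually_ge_atTop b] with i hi ha hb x hx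
  have hpi := hp i x ⟨by linarith [hx.1], hx.2.trans hb⟩
  rw [Pi.zero_apply, dist_zero_left, Real.norm_eq_abs, abs_sub_comm]
  exact hpi.trans hi
end

section
/- Every continuously represented pointwise extrafunction has a differentiable representing sequence: for every sequence (f i)_{i ∈ ℕ} of continuous functions ℝ → ℝ there exists a sequence (g i)_{i ∈ ℕ} of infinitely differentiable functions such that for every x ∈ ℝ, |f i (x) - g i (x)| → 0 as i → ∞. Hence the bundle of continuously represented pointwise extrafunctions has differentially represented sections. -/
open Filter

/-- Every continuously represented pointwise extrafunction has a differentiable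
representing sequence: any sequence of continuous functions `ℝ → ℝ` is
`≈_pt`-equivalent to a sequence of infinitely differentiable functions, the
equivalence being pointwise convergence of the difference to zero. Hence the
bundle of continuously represented pointwise extrafunctions has differentially
represented sections. -/
theorem pointwise_differentially_represented (f : ℕ → ℝ → ℝ)
    (hf : ∀ i, Continuous (f i)) :
    ∃ g : ℕ → ℝ → ℝ,
      (∀ i, ContDiff ℝ (⊤ : ℕ∞) (g i)) ∧
      ∀ x : ℝ, Tendsto (fun i => |f i x - g i x|) atTop (nhds 0) := by
  choose g g_smooth g_near _ using fun i : ℕ =>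
    (hf i).exists_contDiff_approx ⊤ (ε := fun _ => 1 / ((i : ℝ) + 1)) continuous_const
      (fun _ => Nat.one_div_pos_of_nat)
  refine ⟨g, g_smooth, fun x => ?_⟩
  refine squeeze_zero (fun _ => abs_nonneg _) (fun i => ?_)
    (tendsto_one_div_add_atTop_nhds_zero_nat (𝕜 := ℝ))
  rw [← Real.dist_eq, dist_comm]
  exact (g_near i x).le
end
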